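/- Every generalized barbell H satisfies at least one of the following: (i) H can be decomposed into balanced circuits (i.e. its edge set is the disjoint union of edge sets of balanced circuits); or (ii) H has a signed circuit {1,2}-cover F together with two edge-disjoint unbalanced circuits C₁ and C₂ of H all of whose edges are covered by F exactly once. -/

import Mathlib

open scoped Classical

noncomputable section

/-- A signed (multi)graph: a finite multigraph (loops and multiple edges allowed)
together with a sign on each edge (`neg e = true` means `e` is negative). -/
structure SignedMultigraph where
  V : Type
  E : Type
  [fintypeV : Fintype V]
  [fintypeE : Fintype E]
  ends : E → Sym2 V
  neg : E → Bool

attribute [instance] SignedMultigraph.fintypeV SignedMultigraph.fintypeE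

namespace SignedMultigraph

variable (G : SignedMultigraph)

/-- The vertices incident with at least one edge of `S`. -/
def support (S : Finset G.E) : Finset G.V :=
  Finset.univ.filter fun v => ∃ e ∈ S, v ∈ G.ends e

/-- Degree of `v` in the edge set `S`; loops count twice. -/
def degIn (S : Finset G.E) (v : G.V) : ℕ :=
  ∑ e ∈ S, (if G.ends e = Sym2.diag v then 2 else if v ∈ G.ends e then 1 else 0)

/-- `u` and `v` are joined by an edge of `S`. -/
def Adj (S : Finset G.E) (u v : G.V) : Prop := ∃ e ∈ S, G.ends e = s(u, v)

/-- Reachability using only edges of `S`. -/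
def Reach (S : Finset G.E) : G.V → G.V → Prop := Relation.ReflTransGen (G.Adj S)

/-- The subgraph with edge set `S` (and vertex set its support) is connected. -/
def ConnOn (S : Finset G.E) : Prop :=
  ∀ u ∈ G.support S, ∀ v ∈ G.support S, G.Reach S u v

/-- The whole signed graph is connected. -/
def Connected : Prop := Nonempty G.V ∧ ∀ u v : G.V, G.Reach Finset.univ u v

/-- The negative edges among `S`. -/
def negEdges (S : Finset G.E) : Finset G.E := S.filter fun e => G.neg e = true

/-- A circuit: a (nonempty) connected 2-regular subgraph, given by its edge set. -/
def IsCircuit (S : Finset G.E) : Prop :=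
  S.Nonempty ∧ G.ConnOn S ∧ ∀ v ∈ G.support S, G.degIn S v = 2

/-- A balanced circuit: a circuit with an even number of negative edges. -/
def IsBalancedCircuit (S : Finset G.E) : Prop :=
  G.IsCircuit S ∧ Even (G.negEdges S).card

/-- An unbalanced circuit: a circuit with an odd number of negative edges. -/
def IsUnbalancedCircuit (S : Finset G.E) : Prop :=
  G.IsCircuit S ∧ ¬ Even (G.negEdges S).card

/-- A short barbell: two unbalanced circuits meeting at exactly one vertex. -/
def IsShortBarbell (S : Finset G.E) : Prop :=
  ∃ C₁ C₂ : Finset G.E, G.IsUnbalancedCircuit C₁ ∧ G.IsUnbalancedCircuit C₂ ∧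
    Disjoint C₁ C₂ ∧ (G.support C₁ ∩ G.support C₂).card = 1 ∧ S = C₁ ∪ C₂

/-- A path with (distinct) ends `u` and `v`, given by its edge set. -/
def IsPath (P : Finset G.E) (u v : G.V) : Prop :=
  P.Nonempty ∧ G.ConnOn P ∧ u ≠ v ∧ u ∈ G.support P ∧ v ∈ G.support P ∧
    G.degIn P u = 1 ∧ G.degIn P v = 1 ∧
    ∀ w ∈ G.support P, w ≠ u → w ≠ v → G.degIn P w = 2

/-- A long barbell: two vertex-disjoint unbalanced circuits joined by a path
meeting the circuits only at its ends. -/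
def IsLongBarbell (S : Finset G.E) : Prop :=
  ∃ (C₁ C₂ P : Finset G.E) (u v : G.V),
    G.IsUnbalancedCircuit C₁ ∧ G.IsUnbalancedCircuit C₂ ∧
    Disjoint (G.support C₁) (G.support C₂) ∧
    G.IsPath P u v ∧
    G.support P ∩ G.support C₁ = {u} ∧ G.support P ∩ G.support C₂ = {v} ∧
    Disjoint P C₁ ∧ Disjoint P C₂ ∧
    S = C₁ ∪ C₂ ∪ P

/-- A signed circuit: a balanced circuit, a short barbell, or a long barbell. -/
def IsSignedCircuit (S : Finset G.E) : Prop :=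
  G.IsBalancedCircuit S ∨ G.IsShortBarbell S ∨ G.IsLongBarbell S

/-- The number of members of the family `F` containing the edge `e`. -/
def coverCount (F : Multiset (Finset G.E)) (e : G.E) : ℕ :=
  (F.filter fun S => e ∈ S).card

/-- The total length of the family `F`. -/
def coverLength (F : Multiset (Finset G.E)) : ℕ := (F.map Finset.card).sum

/-- A signed circuit cover: every edge is in at least one member. -/
def IsSignedCircuitCover (F : Multiset (Finset G.E)) : Prop :=
  (∀ S ∈ F, G.IsSignedCircuit S) ∧ ∀ e : G.E, 1 ≤ G.coverCount F e

/-- The length of a shortest signed circuit cover. -/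
def SCC : ℕ := sInf { n | ∃ F, G.IsSignedCircuitCover F ∧ G.coverLength F = n }

/-- Whether edge `e` has exactly one endpoint in the vertex set `A`. -/
def crossesB (A : Finset G.V) (e : G.E) : Bool :=
  Sym2.lift ⟨fun x y => Bool.xor (decide (x ∈ A)) (decide (y ∈ A)),
    fun x y => Bool.xor_comm _ _⟩ (G.ends e)

/-- Sign of `e` (`true` = negative) after switching at every vertex of `A`. -/
def negAfter (A : Finset G.V) (e : G.E) : Bool :=
  Bool.xor (G.neg e) (G.crossesB A e)

/-- Minimum number of negative edges in `S` over all switchings. -/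
def negOf (S : Finset G.E) : ℕ :=
  sInf { n | ∃ A : Finset G.V, (S.filter fun e => G.negAfter A e = true).card = n }

/-- The negativeness of `G`. -/
def negativeness : ℕ := G.negOf Finset.univ

/-- The edges of `S` with exactly one endpoint in `U`: the edge boundary `δ(U)` inside `S`. -/
def boundary (S : Finset G.E) (U : Finset G.V) : Finset G.E :=
  S.filter fun e => G.crossesB U e = true

/-- `b` is a bridge of the subgraph with edge set `S`. -/
def IsBridge (S : Finset G.E) (b : G.E) : Prop :=
  ∃ U : Finset G.V, G.boundary S U = {b}

/-- The subgraph with edge set `S` is bridgeless. -/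
def Bridgeless (S : Finset G.E) : Prop := ∀ b ∈ S, ¬ G.IsBridge S b

/-- `G` is 2-edge-connected. -/
def TwoEdgeConnected : Prop :=
  G.Connected ∧ ∀ b : G.E, ¬ G.IsBridge Finset.univ b

/-- Edges of `S` lying in the same component (of the subgraph with edge set `S`)
as the vertex `x`. -/
def compEdges (S : Finset G.E) (x : G.V) : Finset G.E :=
  S.filter fun e => ∃ u, u ∈ G.ends e ∧ G.Reach S x u

/-- A g-bridge: a bridge such that both components of `G - b` have even negativeness. -/
def IsGBridge (b : G.E) : Prop :=
  G.IsBridge Finset.univ b ∧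
    ∃ x y : G.V, G.ends b = s(x, y) ∧
      Even (G.negOf (G.compEdges (Finset.univ.erase b) x)) ∧
      Even (G.negOf (G.compEdges (Finset.univ.erase b) y))

/-- `G` has no g-bridge (in any of its components). -/
def GBridgeless : Prop := ∀ b : G.E, ¬ G.IsGBridge b

/-- Member of `B_g(G)`: a bridge such that at least one component of `G - b`
contains an odd number of negative edges. -/
def IsBgBridge (b : G.E) : Prop :=
  G.IsBridge Finset.univ b ∧
    ∃ x : G.V, x ∈ G.ends b ∧
      ¬ Even (G.negEdges (G.compEdges (Finset.univ.erase b) x)).card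

/-- Member of `B_s(G)`: a bridge such that each of the two components of `G - b`
contains a negative edge. -/
def IsSBridge (b : G.E) : Prop :=
  G.IsBridge Finset.univ b ∧
    ∃ x y : G.V, G.ends b = s(x, y) ∧
      (G.negEdges (G.compEdges (Finset.univ.erase b) x)).Nonempty ∧
      (G.negEdges (G.compEdges (Finset.univ.erase b) y)).Nonempty

/-- `G` is s-bridgeless: every edge lies in some signed circuit. -/
def SBridgeless : Prop := ∀ e : G.E, ∃ S : Finset G.E, G.IsSignedCircuit S ∧ e ∈ S

/-- `{e, f}` is a 2-edge-cut of `G`. -/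
def IsTwoEdgeCut (e f : G.E) : Prop :=
  e ≠ f ∧ ∃ U : Finset G.V, G.boundary Finset.univ U = {e, f}

/-- `S_G(e) = {e} ∪ {f : {e,f} is a 2-edge-cut of G}`. -/
def SSet (e : G.E) : Finset G.E :=
  insert e (Finset.univ.filter fun f => G.IsTwoEdgeCut e f)

/-- The edge set `R` spans an acyclic subgraph (every nonempty subset has a
vertex of degree one). -/
def AcyclicSet (R : Finset G.E) : Prop :=
  ∀ F ⊆ R, F.Nonempty → ∃ v : G.V, G.degIn F v = 1

/-- `T` is the edge set of a spanning tree of `G`. -/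
def IsSpanningTree (T : Finset G.E) : Prop :=
  G.AcyclicSet T ∧ Nonempty G.V ∧ ∀ u v : G.V, G.Reach T u v

/-- `G` is eulerian: connected with all degrees even. -/
def Eulerian : Prop :=
  G.Connected ∧ ∀ v : G.V, Even (G.degIn Finset.univ v)

/-- The edge set `S` spans an eulerian subgraph. -/
def IsEulerianSub (S : Finset G.E) : Prop :=
  S.Nonempty ∧ G.ConnOn S ∧ ∀ v ∈ G.support S, Even (G.degIn S v)

/-- The vertex class of `v` after contracting each member of `ℬ`. -/
def classOf (ℬ : Finset (Finset G.E)) (v : G.V) : Finset G.V :=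
  Finset.univ.filter fun u => u = v ∨ ∃ B ∈ ℬ, v ∈ G.support B ∧ u ∈ G.support B

/-- Degree, in edge set `F`, of the contracted class of `v`. -/
def classDeg (ℬ : Finset (Finset G.E)) (F : Finset G.E) (v : G.V) : ℕ :=
  ∑ u ∈ G.classOf ℬ v, G.degIn F u

/-- `ℬ` witnesses that the subgraph with edge set `S` is a generalized barbell:
`ℬ` is a family of vertex-disjoint eulerian subgraphs of `S`, the contraction
`S/(∪ℬ)` is acyclic, and for every vertex `x` of the contracted graph,
`|E_N(B_x)| ≡ |δ(V(B_x))| (mod 2)`. -/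
def GenBarbellWitness (S : Finset G.E) (ℬ : Finset (Finset G.E)) : Prop :=
  (∀ B ∈ ℬ, B ⊆ S ∧ G.IsEulerianSub B) ∧
  (∀ B₁ ∈ ℬ, ∀ B₂ ∈ ℬ, B₁ ≠ B₂ → Disjoint (G.support B₁) (G.support B₂)) ∧
  (∀ F ⊆ S \ ℬ.sup id, F.Nonempty → ∃ v : G.V, G.classDeg ℬ F v = 1) ∧
  (∀ B ∈ ℬ, (G.negEdges B).card ≡ (G.boundary S (G.support B)).card [MOD 2]) ∧
  (∀ v ∈ G.support S, (∀ B ∈ ℬ, v ∉ G.support B) → Even (G.boundary S {v}).card)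

/-- The subgraph with edge set `S` is a generalized barbell. -/
def IsGenBarbell (S : Finset G.E) : Prop := ∃ ℬ, G.GenBarbellWitness S ℬ

end SignedMultigraph

namespace SignedMultigraph

variable {G : SignedMultigraph}

theorem mem_support {S : Finset G.E} {v : G.V} : v ∈ G.support S ↔ ∃ e ∈ S, v ∈ G.ends e := by
  simp [support]

theorem exists_ends (e : G.E) : ∃ a b, G.ends e = s(a, b) :=
  Sym2.ind (f := fun z => ∃ a b, z = s(a, b)) (fun a b => ⟨a, b, rfl⟩) (G.ends e)

theorem support_mono {S T : Finset G.E} (h : S ⊆ T) : G.support S ⊆ G.support T := by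
  intro v hv
  obtain ⟨e, he, hve⟩ := mem_support.1 hv
  exact mem_support.2 ⟨e, h he, hve⟩

theorem support_union (S T : Finset G.E) : G.support (S ∪ T) = G.support S ∪ G.support T := by
  ext v
  simp only [mem_support, Finset.mem_union]
  grind

/-! ### Degrees -/

theorem degIn_singleton {e : G.E} {a b : G.V} (h : G.ends e = s(a, b)) (v : G.V) :
    G.degIn {e} v = (if v = a then 1 else 0) + (if v = b then 1 else 0) := by
  simp only [degIn, Finset.sum_singleton, h, Sym2.diag, Sym2.mem_iff, Sym2.eq_iff]
  split_ifs <;> grind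

theorem degIn_eq_sum (S : Finset G.E) (v : G.V) : G.degIn S v = ∑ e ∈ S, G.degIn {e} v := by
  simp [degIn]

theorem degIn_union {S T : Finset G.E} (h : Disjoint S T) (v : G.V) :
    G.degIn (S ∪ T) v = G.degIn S v + G.degIn T v :=
  Finset.sum_union h

theorem degIn_sdiff_add {S T : Finset G.E} (h : T ⊆ S) (v : G.V) :
    G.degIn (S \ T) v + G.degIn T v = G.degIn S v :=
  Finset.sum_sdiff h

theorem degIn_mono {S T : Finset G.E} (h : S ⊆ T) (v : G.V) : G.degIn S v ≤ G.degIn T v := by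
  have := degIn_sdiff_add h v
  omega

theorem degIn_eq_zero_iff {S : Finset G.E} {v : G.V} : G.degIn S v = 0 ↔ v ∉ G.support S := by
  rw [degIn_eq_sum, Finset.sum_eq_zero_iff, mem_support]
  push Not
  refine forall₂_congr fun e _ => ?_
  obtain ⟨a, b, hab⟩ := exists_ends e
  rw [degIn_singleton hab, hab, Sym2.mem_iff]
  split_ifs <;> simp_all

theorem degIn_symmDiff (S T : Finset G.E) (v : G.V) :
    (G.degIn (symmDiff S T) v : ZMod 2) = G.degIn S v + G.degIn T v := by
  have h1 : G.degIn (symmDiff S T) v = G.degIn (S \ T) v + G.degIn (T \ S) v :=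
    degIn_union disjoint_sdiff_sdiff v
  have h2 := degIn_sdiff_add (Finset.inter_subset_left : S ∩ T ⊆ S) v
  have h3 := degIn_sdiff_add (Finset.inter_subset_right : S ∩ T ⊆ T) v
  rw [Finset.sdiff_inter_self_left] at h2
  rw [Finset.sdiff_inter_self_right] at h3
  rw [h1, ← h2, ← h3]
  push_cast
  linear_combination -(CharTwo.add_self_eq_zero (G.degIn (S ∩ T) v : ZMod 2))

theorem crossesB_iff {e : G.E} {a b : G.V} (h : G.ends e = s(a, b)) (W : Finset G.V) :
    G.crossesB W e = true ↔ ¬ (a ∈ W ↔ b ∈ W) := by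
  simp only [crossesB, h, Sym2.lift_mk]
  by_cases ha : a ∈ W <;> by_cases hb : b ∈ W <;> simp [ha, hb]

/-- The handshake lemma for a vertex subset, modulo 2. -/
theorem sum_degIn_eq_card_boundary (S : Finset G.E) (W : Finset G.V) :
    ∑ v ∈ W, (G.degIn S v : ZMod 2) = ((G.boundary S W).card : ZMod 2) := by
  simp_rw [degIn_eq_sum S, Nat.cast_sum]
  rw [Finset.sum_comm, boundary, Finset.card_filter, Nat.cast_sum]
  refine Finset.sum_congr rfl fun e _ => ?_
  obtain ⟨a, b, hab⟩ := exists_ends e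
  simp only [degIn_singleton hab, Nat.cast_add, Nat.cast_ite, Nat.cast_one, Nat.cast_zero,
    Finset.sum_add_distrib, Finset.sum_ite_eq', crossesB_iff hab]
  by_cases ha : a ∈ W <;> by_cases hb : b ∈ W <;> simp [ha, hb]
  exact CharTwo.add_self_eq_zero 1

/-! ### Reachability -/

theorem Adj.symm {S : Finset G.E} {u v : G.V} (h : G.Adj S u v) : G.Adj S v u := by
  obtain ⟨e, he, h⟩ := h
  exact ⟨e, he, h.trans Sym2.eq_swap⟩

theorem Reach.symm {S : Finset G.E} {u v : G.V} (h : G.Reach S u v) : G.Reach S v u := by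
  induction h with
  | refl => exact Relation.ReflTransGen.refl
  | tail _ hbc ih => exact Relation.ReflTransGen.head (Adj.symm hbc) ih

theorem Reach.trans {S : Finset G.E} {u v w : G.V} (h : G.Reach S u v) (h' : G.Reach S v w) :
    G.Reach S u w :=
  Relation.ReflTransGen.trans h h'

theorem Reach.refl (S : Finset G.E) (u : G.V) : G.Reach S u u :=
  Relation.ReflTransGen.refl

theorem Reach.mono {S T : Finset G.E} (hST : S ⊆ T) {u v : G.V} (h : G.Reach S u v) :
    G.Reach T u v :=
  Relation.ReflTransGen.mono (fun _ _ ⟨e, he, h⟩ => ⟨e, hST he, h⟩) _ _ h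

theorem Reach.of_mem_ends {S : Finset G.E} {e : G.E} (he : e ∈ S) {u v : G.V}
    (hu : u ∈ G.ends e) (hv : v ∈ G.ends e) : G.Reach S u v := by
  by_cases huv : u = v
  · exact huv ▸ Reach.refl S u
  · exact Relation.ReflTransGen.single ⟨e, he, (Sym2.mem_and_mem_iff huv).1 ⟨hu, hv⟩⟩

/-- A walk leaving a vertex set uses a crossing edge. -/
theorem Reach.exists_crossing {S : Finset G.E} {W : Finset G.V} {u v : G.V} (h : G.Reach S u v)
    (hu : u ∈ W) (hv : v ∉ W) : (G.boundary S W).Nonempty := by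
  induction h with
  | refl => exact absurd hu hv
  | @tail b c _ hbc ih =>
    by_cases hb : b ∈ W
    · obtain ⟨e, he, hends⟩ := hbc
      exact ⟨e, Finset.mem_filter.2 ⟨he, (crossesB_iff hends W).2 (by tauto)⟩⟩
    · exact ih hb

/-- Walk until the first vertex of `C`, if there is one. -/
theorem Reach.avoid {S C : Finset G.E} {v w : G.V} (h : G.Reach S v w) :
    (∃ u ∈ G.support C, G.Reach (S \ C) v u) ∨ G.Reach (S \ C) v w := by
  induction h with
  | refl => exact Or.inr (Reach.refl _ _)
  | @tail b c _ hbc ih =>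
    refine ih.elim Or.inl fun hb => ?_
    obtain ⟨e, he, hends⟩ := hbc
    by_cases heC : e ∈ C
    · exact Or.inl ⟨b, mem_support.2 ⟨e, heC, by simp [hends]⟩, hb⟩
    · exact Or.inr (hb.tail ⟨e, Finset.mem_sdiff.2 ⟨he, heC⟩, hends⟩)

theorem Reach.exists_mem_support {S C : Finset G.E} {v w : G.V} (h : G.Reach S v w)
    (hw : w ∈ G.support C) : ∃ u ∈ G.support C, G.Reach (S \ C) v u :=
  (h.avoid (C := C)).elim id fun h => ⟨w, hw, h⟩

/-- Among edge sets meeting the component of `v`, some `C` can be deleted while all the others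
still meet the component of `v`. -/
theorem exists_removable {S : Finset G.E} {v : G.V} {𝒰 : Finset (Finset G.E)} (hne : 𝒰.Nonempty)
    (h : ∀ C ∈ 𝒰, ∃ u ∈ G.support C, G.Reach S v u) :
    ∃ C ∈ 𝒰, ∀ C' ∈ 𝒰, ∃ u ∈ G.support C', G.Reach (S \ C) v u := by
  obtain ⟨C, hC, hmax⟩ := 𝒰.exists_max_image
    (fun C => (Finset.univ.filter fun u => G.Reach (S \ C) v u).card) hne
  refine ⟨C, hC, fun C' hC' => ?_⟩
  by_contra! hcon
  refine (hmax C' hC').not_gt (Finset.card_lt_card ?_)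
  obtain ⟨w, hw, hvw⟩ := h C' hC'
  obtain ⟨u, hu, hvu⟩ := hvw.exists_mem_support hw
  refine (Finset.ssubset_iff_of_subset fun x hx => ?_).2 ⟨u, ?_, ?_⟩
  · simp only [Finset.mem_filter, Finset.mem_univ, true_and] at hx ⊢
    rcases hx.avoid (C := C') with ⟨y, hy, hvy⟩ | hvx
    · exact absurd (hvy.mono Finset.sdiff_subset) (hcon y hy)
    · exact hvx.mono (Finset.sdiff_subset_sdiff Finset.sdiff_subset subset_rfl)
  · simpa using hvu
  · simpa using hcon u hu

theorem ConnOn.union {S T : Finset G.E} (hS : G.ConnOn S) (hT : G.ConnOn T) {a : G.V}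
    (haS : a ∈ G.support S) (haT : a ∈ G.support T) : G.ConnOn (S ∪ T) := by
  have key : ∀ u ∈ G.support (S ∪ T), G.Reach (S ∪ T) u a := by
    intro u hu
    rw [support_union, Finset.mem_union] at hu
    rcases hu with hu | hu
    · exact (hS u hu a haS).mono Finset.subset_union_left
    · exact (hT u hu a haT).mono Finset.subset_union_right
  exact fun u hu v hv => (key u hu).trans (key v hv).symm

theorem boundary_reach_eq_empty (S : Finset G.E) (x : G.V) :
    G.boundary S (Finset.univ.filter fun u => G.Reach S x u) = ∅ := by
  refine Finset.filter_eq_empty_iff.2 fun e he => ?_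
  obtain ⟨a, b, hab⟩ := exists_ends e
  rw [crossesB_iff hab, not_not]
  have hr : G.Reach S a b := Reach.of_mem_ends he (by simp [hab]) (by simp [hab])
  simp only [Finset.mem_filter, Finset.mem_univ, true_and]
  exact ⟨fun h => h.trans hr, fun h => h.trans hr.symm⟩

/-! ### Paths -/

theorem support_singleton {e : G.E} {a b : G.V} (h : G.ends e = s(a, b)) :
    G.support {e} = {a, b} := by
  ext v
  simp [mem_support, h]

theorem isPath_singleton {e : G.E} {a b : G.V} (h : G.ends e = s(a, b)) (hab : a ≠ b) :
    G.IsPath {e} a b := by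
  refine ⟨by simp, ?_, hab, ?_, ?_, ?_, ?_, ?_⟩
  · intro u hu v hv
    simp only [mem_support, Finset.mem_singleton, exists_eq_left] at hu hv
    exact Reach.of_mem_ends (Finset.mem_singleton_self e) hu hv
  · simp [support_singleton h]
  · simp [support_singleton h]
  · simp [degIn_singleton h, hab]
  · simp [degIn_singleton h, hab.symm]
  · intro w hw hwa hwb
    simp [support_singleton h, hwa, hwb] at hw

theorem IsPath.cons {P : Finset G.E} {e : G.E} {x z y : G.V} (hP : G.IsPath P z y)
    (he : G.ends e = s(x, z)) (hx : x ∉ G.support P) : G.IsPath (insert e P) x y := by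
  obtain ⟨hne, hconn, hzy, hz, hy, dz, dy, hdeg⟩ := hP
  have hxz : x ≠ z := fun h => hx (h ▸ hz)
  have hxy : x ≠ y := fun h => hx (h ▸ hy)
  have heP : e ∉ P := fun h => hx (mem_support.2 ⟨e, h, by simp [he]⟩)
  have hd : ∀ v, G.degIn (insert e P) v
      = (if v = x then 1 else 0) + (if v = z then 1 else 0) + G.degIn P v := fun v => by
    rw [Finset.insert_eq, degIn_union (by simpa using heP), degIn_singleton he]
  have hs : G.support (insert e P) = {x, z} ∪ G.support P := by
    rw [Finset.insert_eq, support_union, support_singleton he]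
  refine ⟨by simp, ?_, hxy, by simp [hs], by simp [hs, hy], ?_, ?_, ?_⟩
  · rw [Finset.insert_eq]
    exact (isPath_singleton he hxz).2.1.union hconn (a := z) (by simp [support_singleton he]) hz
  · simp [hd, hxz, degIn_eq_zero_iff.2 hx]
  · simp [hd, hxy.symm, hzy.symm, dy]
  · intro w hw hwx hwy
    rw [hd]
    by_cases hwz : w = z
    · simp [hwz, hxz.symm, dz]
    · simp only [hs, Finset.mem_union, Finset.mem_insert, Finset.mem_singleton, hwx, hwz,
        false_or] at hw
      simp [hwx, hwz, hdeg w hw hwz hwy]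

/-- Consider the last time a walk from `x` leaves `x`. -/
theorem Reach.last_departure {S : Finset G.E} {x y : G.V} (h : G.Reach S x y) :
    y = x ∨ ∃ e ∈ S, ∃ z, G.ends e = s(x, z) ∧ z ≠ x ∧
      G.Reach (S.filter fun e => x ∉ G.ends e) z y := by
  induction h with
  | refl => exact Or.inl rfl
  | @tail b c _ hbc ih =>
    by_cases hc : c = x
    · exact Or.inl hc
    obtain ⟨f, hf, hends⟩ := hbc
    refine Or.inr ?_
    by_cases hb : b = x
    · exact ⟨f, hf, c, hb ▸ hends, hc, Reach.refl _ _⟩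
    · obtain ⟨e, he, z, h1, h2, h3⟩ := ih.resolve_left hb
      refine ⟨e, he, z, h1, h2, h3.tail ⟨f, Finset.mem_filter.2 ⟨hf, ?_⟩, hends⟩⟩
      rw [hends, Sym2.mem_iff]
      exact fun h => h.elim (fun h => hb h.symm) fun h => hc h.symm

theorem Reach.exists_isPath {S : Finset G.E} {x y : G.V} (h : G.Reach S x y) (hxy : x ≠ y) :
    ∃ P ⊆ S, G.IsPath P x y := by
  induction hn : S.card using Nat.strong_induction_on generalizing S x with
  | _ n ih =>
    obtain ⟨e, he, z, hends, hzx, hr⟩ := h.last_departure.resolve_left hxy.symm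
    by_cases hzy : z = y
    · exact ⟨{e}, by simpa using he, isPath_singleton (hzy ▸ hends) hxy⟩
    have hlt : (S.filter fun e => x ∉ G.ends e).card < n :=
      hn ▸ Finset.card_lt_card (Finset.filter_ssubset.2 ⟨e, he, by simp [hends]⟩)
    obtain ⟨P, hPS, hP⟩ := ih _ hlt hr hzy rfl
    refine ⟨insert e P, ?_, hP.cons hends fun hx => ?_⟩
    · exact Finset.insert_subset he (hPS.trans (Finset.filter_subset _ _))
    · obtain ⟨f, hf, hxf⟩ := mem_support.1 hx
      exact (Finset.mem_filter.1 (hPS hf)).2 hxf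

theorem IsPath.reach {P : Finset G.E} {x y : G.V} (h : G.IsPath P x y) : G.Reach P x y :=
  h.2.1 x h.2.2.2.1 y h.2.2.2.2.1

theorem IsPath.degIn_parity {P : Finset G.E} {x y : G.V} (h : G.IsPath P x y) (v : G.V) :
    (G.degIn P v : ZMod 2) = (if v = x then 1 else 0) + (if v = y then 1 else 0) := by
  obtain ⟨-, -, hxy, hx, hy, dx, dy, hdeg⟩ := h
  by_cases hvx : v = x
  · subst hvx
    simp [dx, hxy]
  by_cases hvy : v = y
  · subst hvy
    simp [dy, hvx]
  by_cases hv : v ∈ G.support P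
  · simpa [hdeg v hv hvx hvy, hvx, hvy] using CharTwo.two_eq_zero (R := ZMod 2)
  · simp [degIn_eq_zero_iff.2 hv, hvx, hvy]

theorem Reach.exists_parity_path {S : Finset G.E} {x y : G.V} (h : G.Reach S x y) :
    ∃ P ⊆ S, G.Reach P x y ∧
      ∀ v, (G.degIn P v : ZMod 2) = (if v = x then 1 else 0) + (if v = y then 1 else 0) := by
  by_cases hxy : x = y
  · refine ⟨∅, by simp, hxy ▸ Reach.refl _ _, fun v => ?_⟩
    subst hxy
    rw [CharTwo.add_self_eq_zero]
    simp [degIn]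
  · obtain ⟨P, hPS, hP⟩ := h.exists_isPath hxy
    exact ⟨P, hPS, hP.reach, hP.degIn_parity⟩

/-- In a set whose degrees are odd exactly at `x` and `y`, these vertices are connected. -/
theorem reach_of_odd {S : Finset G.E} {x y : G.V}
    (h : ∀ v, (G.degIn S v : ZMod 2) = (if v = x then 1 else 0) + (if v = y then 1 else 0)) :
    G.Reach S x y := by
  by_contra hxy
  have hb : G.boundary S (Finset.univ.filter fun u => G.Reach S x u) = ∅ :=
    boundary_reach_eq_empty S x
  have := sum_degIn_eq_card_boundary S (Finset.univ.filter fun u => G.Reach S x u)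
  rw [hb] at this
  simp [h, Finset.sum_add_distrib, hxy, Reach.refl] at this

/-! ### Circuits -/

theorem IsPath.isCircuit_union {P Q : Finset G.E} {a b : G.V} (hP : G.IsPath P a b)
    (hQ : G.IsPath Q a b) (hPQ : Disjoint P Q)
    (h : ∀ v ∈ G.support P, v ∈ G.support Q → v = a ∨ v = b) : G.IsCircuit (P ∪ Q) := by
  obtain ⟨hne, hconn, hab, ha, hb, da, db, hdeg⟩ := hP
  obtain ⟨hne', hconn', -, ha', hb', da', db', hdeg'⟩ := hQ
  refine ⟨hne.mono Finset.subset_union_left, hconn.union hconn' ha ha', fun v hv => ?_⟩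
  rw [degIn_union hPQ]
  by_cases hva : v = a
  · subst hva; omega
  by_cases hvb : v = b
  · subst hvb; omega
  rw [support_union, Finset.mem_union] at hv
  by_cases hvP : v ∈ G.support P
  · rw [hdeg v hvP hva hvb, degIn_eq_zero_iff.2 fun hvQ => (h v hvP hvQ).elim hva hvb]
  · rw [hdeg' v (hv.resolve_left hvP) hva hvb, degIn_eq_zero_iff.2 hvP]

theorem IsCircuit.degIn_parity {C : Finset G.E} (hC : G.IsCircuit C) (v : G.V) :
    (G.degIn C v : ZMod 2) = 0 := by
  by_cases hv : v ∈ G.support C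
  · rw [hC.2.2 v hv]
    exact CharTwo.two_eq_zero
  · simp [degIn_eq_zero_iff.2 hv]

theorem exists_isCircuit {S : Finset G.E} (hS : ∀ v, (G.degIn S v : ZMod 2) = 0) {e : G.E}
    (he : e ∈ S) : ∃ C ⊆ S, e ∈ C ∧ G.IsCircuit C := by
  obtain ⟨a, b, hab⟩ := exists_ends e
  have heS : {e} ⊆ S := by simpa using he
  by_cases h : a = b
  · subst h
    refine ⟨{e}, heS, by simp, by simp, fun u hu v hv => ?_, fun v hv => ?_⟩
    · simp only [mem_support, Finset.mem_singleton, exists_eq_left] at hu hv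
      exact Reach.of_mem_ends (Finset.mem_singleton_self e) hu hv
    · have hva : v = a := by simpa [support_singleton hab] using hv
      simp [degIn_singleton hab, hva]
  · have hr : G.Reach (S \ {e}) a b := by
      refine reach_of_odd fun v => ?_
      have h1 := congrArg (Nat.cast (R := ZMod 2)) (degIn_sdiff_add heS v)
      rw [Nat.cast_add, hS, degIn_singleton hab] at h1
      simpa using CharTwo.add_eq_zero.1 h1
    obtain ⟨P, hPS, hP⟩ := hr.exists_isPath h
    refine ⟨{e} ∪ P, Finset.union_subset heS (hPS.trans Finset.sdiff_subset), by simp,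
      (isPath_singleton hab h).isCircuit_union hP ?_ fun v hv _ => ?_⟩
    · exact Finset.disjoint_of_subset_right hPS Finset.disjoint_sdiff
    · simpa [support_singleton hab] using hv

/-- A path that is shortest among those joining a pair of vertices related by `p` contains no
further such pair. -/
theorem Reach.exists_minimal_isPath {S : Finset G.E} {p : G.V → G.V → Prop}
    (hp : ∀ a b, p a b → a ≠ b) {x y : G.V} (hxy : p x y) (hr : G.Reach S x y) :
    ∃ P ⊆ S, ∃ a b, p a b ∧ G.IsPath P a b ∧
      ∀ c d, p c d → c ∈ G.support P → d ∈ G.support P → (c = a ∨ c = b) ∧ (d = a ∨ d = b) := by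
  obtain ⟨P, hP, hmin⟩ :=
    (S.powerset.filter fun P => ∃ a b, p a b ∧ G.IsPath P a b).exists_min_image Finset.card (by
      obtain ⟨P, hPS, hP⟩ := hr.exists_isPath (hp x y hxy)
      exact ⟨P, by simpa [hPS] using ⟨x, y, hxy, hP⟩⟩)
  simp only [Finset.mem_filter, Finset.mem_powerset] at hP hmin
  obtain ⟨hPS, a, b, hab, hP⟩ := hP
  refine ⟨P, hPS, a, b, hab, hP, fun c d hcd hc hd => ?_⟩
  obtain ⟨Q, hQP, hQ⟩ := Reach.exists_isPath (hP.2.1 c hc d hd) (hp c d hcd)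
  obtain rfl : Q = P :=
    Finset.eq_of_subset_of_card_le hQP (hmin Q ⟨hQP.trans hPS, c, d, hcd, hQ⟩)
  have hend : ∀ w ∈ G.support Q, G.degIn Q w = 1 → w = a ∨ w = b := fun w hw h1 => by
    by_contra! hcon
    have := hP.2.2.2.2.2.2.2 w hw hcon.1 hcon.2
    omega
  exact ⟨hend c hc hQ.2.2.2.2.2.1, hend d hd hQ.2.2.2.2.2.2.1⟩

theorem card_negEdges_union {S T : Finset G.E} (h : Disjoint S T) :
    (G.negEdges (S ∪ T)).card = (G.negEdges S).card + (G.negEdges T).card := by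
  rw [negEdges, Finset.filter_union,
    Finset.card_union_of_disjoint (Finset.disjoint_filter_filter h)]
  rfl

/-- A theta graph contains a balanced circuit, so two disjoint circuits of a graph without
balanced circuits have at most one common vertex. -/
theorem card_support_inter_le_one {S C C' : Finset G.E}
    (hS : ∀ D ⊆ S, ¬ G.IsBalancedCircuit D) (hC : G.IsCircuit C) (hC' : G.IsCircuit C')
    (hCS : C ⊆ S) (hCS' : C' ⊆ S) (hd : Disjoint C C') :
    (G.support C ∩ G.support C').card ≤ 1 := by
  by_contra! hcard
  obtain ⟨x, hx, y, hy, hxy⟩ := Finset.one_lt_card.1 hcard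
  rw [Finset.mem_inter] at hx hy
  obtain ⟨P, hPC, a, b, ⟨ha, hb, hab⟩, hP, hmin⟩ :=
    Reach.exists_minimal_isPath (p := fun a b => a ∈ G.support C ∧ b ∈ G.support C ∧ a ≠ b)
      (fun _ _ h => h.2.2) ⟨hx.1, hy.1, hxy⟩ (hC'.2.1 x hx.2 y hy.2)
  have hPC_inter : ∀ v ∈ G.support C, v ∈ G.support P → v = a ∨ v = b := fun v hvC hvP => by
    by_cases hva : v = a
    · exact Or.inl hva
    · exact (hmin v a ⟨hvC, ha, hva⟩ hvP hP.2.2.2.1).1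
  obtain ⟨Q, hQC, hQ⟩ := Reach.exists_isPath (hC.2.1 a ha b hb) hab
  have hr : G.Reach (C \ Q) a b := by
    refine reach_of_odd fun v => ?_
    have h1 := congrArg (Nat.cast (R := ZMod 2)) (degIn_sdiff_add hQC v)
    rw [Nat.cast_add, hC.degIn_parity, hQ.degIn_parity] at h1
    exact CharTwo.add_eq_zero.1 h1
  obtain ⟨R, hRC, hR⟩ := hr.exists_isPath hab
  have hQR : Disjoint Q R := Finset.disjoint_of_subset_right hRC Finset.disjoint_sdiff
  have hRC : R ⊆ C := hRC.trans Finset.sdiff_subset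
  have hQP : Disjoint Q P := Finset.disjoint_of_subset_left hQC
    (Finset.disjoint_of_subset_right hPC hd)
  have hRP : Disjoint R P := Finset.disjoint_of_subset_left hRC
    (Finset.disjoint_of_subset_right hPC hd)
  have c1 : G.IsCircuit (Q ∪ R) := hQ.isCircuit_union hR hQR fun v hvQ hvR => by
    by_contra! hcon
    have h1 := hQ.2.2.2.2.2.2.2 v hvQ hcon.1 hcon.2
    have h2 := hR.2.2.2.2.2.2.2 v hvR hcon.1 hcon.2
    have h3 := hC.2.2 v (support_mono hQC hvQ)
    have h4 := degIn_mono (Finset.union_subset hQC hRC) v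
    rw [degIn_union hQR] at h4
    omega
  have c2 : G.IsCircuit (Q ∪ P) := hQ.isCircuit_union hP hQP fun v hvQ hvP =>
    hPC_inter v (support_mono hQC hvQ) hvP
  have c3 : G.IsCircuit (R ∪ P) := hR.isCircuit_union hP hRP fun v hvR hvP =>
    hPC_inter v (support_mono hRC hvR) hvP
  have n1 : ¬ Even _ := fun h =>
    hS _ ((Finset.union_subset hQC hRC).trans hCS) ⟨c1, h⟩
  have n2 : ¬ Even _ := fun h =>
    hS _ (Finset.union_subset (hQC.trans hCS) (hPC.trans hCS')) ⟨c2, h⟩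
  have n3 : ¬ Even _ := fun h =>
    hS _ (Finset.union_subset (hRC.trans hCS) (hPC.trans hCS')) ⟨c3, h⟩
  rw [card_negEdges_union hQR] at n1
  rw [card_negEdges_union hQP] at n2
  rw [card_negEdges_union hRP] at n3
  simp only [Nat.even_iff] at n1 n2 n3
  omega

/-- An even edge set decomposes into circuits, any two unbalanced ones of which have at most one
common vertex. -/
theorem exists_circuit_decomposition (S : Finset G.E) (hS : ∀ v, (G.degIn S v : ZMod 2) = 0) :
    ∃ 𝒟 : Finset (Finset G.E), (∀ C ∈ 𝒟, G.IsCircuit C) ∧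
      (∀ C ∈ 𝒟, ∀ C' ∈ 𝒟, C ≠ C' → Disjoint C C') ∧
      (∀ C ∈ 𝒟, ∀ C' ∈ 𝒟, C ≠ C' → G.IsUnbalancedCircuit C → G.IsUnbalancedCircuit C' →
        (G.support C ∩ G.support C').card ≤ 1) ∧
      ∀ e, e ∈ S ↔ ∃ C ∈ 𝒟, e ∈ C := by
  induction hn : S.card using Nat.strong_induction_on generalizing S with
  | _ n ih =>
    rcases S.eq_empty_or_nonempty with rfl | ⟨e, he⟩
    · exact ⟨∅, by simp⟩
    obtain ⟨C, hCS, hC, hbal⟩ : ∃ C ⊆ S, G.IsCircuit C ∧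
        (G.IsUnbalancedCircuit C → ∀ D ⊆ S, ¬ G.IsBalancedCircuit D) := by
      by_cases h : ∃ D ⊆ S, G.IsBalancedCircuit D
      · obtain ⟨D, hDS, hD⟩ := h
        exact ⟨D, hDS, hD.1, fun hD' => absurd hD.2 hD'.2⟩
      · obtain ⟨C, hCS, -, hC⟩ := exists_isCircuit hS he
        exact ⟨C, hCS, hC, fun _ D hDS hD => h ⟨D, hDS, hD⟩⟩
    have hcard : (S \ C).card < n := by
      rw [← hn]
      exact Finset.card_lt_card (Finset.sdiff_ssubset hCS hC.1)
    obtain ⟨𝒟, h1, h2, h3, h4⟩ := ih _ hcard (S \ C) (fun v => by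
      have h := congrArg (Nat.cast (R := ZMod 2)) (degIn_sdiff_add hCS v)
      rwa [Nat.cast_add, hS, hC.degIn_parity, add_zero] at h) rfl
    have hsub : ∀ D ∈ 𝒟, D ⊆ S \ C := fun D hD e he => (h4 e).2 ⟨D, hD, he⟩
    have hdisj : ∀ D ∈ 𝒟, Disjoint C D := fun D hD =>
      Finset.disjoint_of_subset_right (hsub D hD) Finset.disjoint_sdiff
    have hone : ∀ D ∈ 𝒟, G.IsUnbalancedCircuit C → (G.support C ∩ G.support D).card ≤ 1 :=
      fun D hD hCu => card_support_inter_le_one (hbal hCu) hC (h1 D hD) hCS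
        ((hsub D hD).trans Finset.sdiff_subset) (hdisj D hD)
    refine ⟨insert C 𝒟, ?_, ?_, ?_, fun e => ?_⟩
    · simpa using ⟨hC, h1⟩
    · intro D hD D' hD' hne
      rcases Finset.mem_insert.1 hD with rfl | hD₁ <;>
        rcases Finset.mem_insert.1 hD' with rfl | hD₁'
      · exact absurd rfl hne
      · exact hdisj D' hD₁'
      · exact (hdisj D hD₁).symm
      · exact h2 D hD₁ D' hD₁' hne
    · intro D hD D' hD' hne hDu hDu'
      rcases Finset.mem_insert.1 hD with rfl | hD₁ <;>
        rcases Finset.mem_insert.1 hD' with rfl | hD₁'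
      · exact absurd rfl hne
      · exact hone D' hD₁' hDu
      · rw [Finset.inter_comm]
        exact hone D hD₁ hDu'
      · exact h3 D hD₁ D' hD₁' hne hDu hDu'
    · have h := h4 e
      simp only [Finset.mem_sdiff] at h
      simp only [Finset.mem_insert, exists_eq_or_imp, ← h]
      have := @hCS e
      tauto

/-! ### Barbells -/

/-- Two unbalanced circuits with at most one common vertex, joined by a walk in `P`, span a
barbell. -/
theorem exists_barbell {U U' P : Finset G.E} (hU : G.IsUnbalancedCircuit U)
    (hU' : G.IsUnbalancedCircuit U') (hd : Disjoint U U')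
    (hcard : (G.support U ∩ G.support U').card ≤ 1) {x y : G.V} (hx : x ∈ G.support U)
    (hy : y ∈ G.support U') (hr : G.Reach P x y) :
    ∃ B, G.IsSignedCircuit B ∧ U ∪ U' ⊆ B ∧ B ⊆ U ∪ U' ∪ P ∧ G.Reach B x y := by
  by_cases hdis : Disjoint (G.support U) (G.support U')
  · obtain ⟨Q, hQP, a, b, ⟨ha, hb⟩, hQ, hmin⟩ :=
      Reach.exists_minimal_isPath (p := fun a b => a ∈ G.support U ∧ b ∈ G.support U')
        (fun a b h hab => Finset.disjoint_left.1 hdis h.1 (hab ▸ h.2)) ⟨hx, hy⟩ hr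
    have haQ := hQ.2.2.2.1
    have hbQ := hQ.2.2.2.2.1
    have hQU : G.support Q ∩ G.support U = {a} := by
      refine Finset.eq_singleton_iff_unique_mem.2 ⟨Finset.mem_inter.2 ⟨haQ, ha⟩, fun w hw => ?_⟩
      rw [Finset.mem_inter] at hw
      exact (hmin w b ⟨hw.2, hb⟩ hw.1 hbQ).1.resolve_right fun h =>
        Finset.disjoint_left.1 hdis hw.2 (h ▸ hb)
    have hQU' : G.support Q ∩ G.support U' = {b} := by
      refine Finset.eq_singleton_iff_unique_mem.2 ⟨Finset.mem_inter.2 ⟨hbQ, hb⟩, fun w hw => ?_⟩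
      rw [Finset.mem_inter] at hw
      exact (hmin a w ⟨ha, hw.2⟩ haQ hw.1).2.resolve_left fun h =>
        Finset.disjoint_left.1 hdis ha (h ▸ hw.2)
    have hdj : ∀ {T : Finset G.E} {c : G.V}, G.support Q ∩ G.support T = {c} →
        G.degIn Q c = 1 → Disjoint Q T := fun {T c} hc h1 => by
      refine Finset.disjoint_left.2 fun e heQ heT => ?_
      obtain ⟨u, v, huv⟩ := exists_ends e
      have hmem : ∀ w ∈ G.ends e, w = c := fun w hw => Finset.mem_singleton.1
        (hc ▸ Finset.mem_inter.2 ⟨mem_support.2 ⟨e, heQ, hw⟩, mem_support.2 ⟨e, heT, hw⟩⟩)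
      have hu := hmem u (by simp [huv])
      have hv := hmem v (by simp [huv])
      subst hu
      subst hv
      have := degIn_mono (Finset.singleton_subset_iff.2 heQ) v
      rw [degIn_singleton huv] at this
      simp at this
      omega
    refine ⟨U ∪ U' ∪ Q, Or.inr (Or.inr ⟨U, U', Q, a, b, hU, hU', hdis, hQ, hQU, hQU',
      hdj hQU hQ.2.2.2.2.2.1, hdj hQU' hQ.2.2.2.2.2.2.1, rfl⟩), Finset.subset_union_left,
      Finset.union_subset_union_right hQP, ?_⟩
    have h1 := (hU.1.2.1 x hx a ha).mono
      (Finset.subset_union_left.trans Finset.subset_union_left : U ⊆ U ∪ U' ∪ Q)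
    have h2 := hQ.reach.mono (Finset.subset_union_right : Q ⊆ U ∪ U' ∪ Q)
    have h3 := (hU'.1.2.1 b hb y hy).mono
      (Finset.subset_union_right.trans Finset.subset_union_left : U' ⊆ U ∪ U' ∪ Q)
    exact (h1.trans h2).trans h3
  · obtain ⟨c, hc, hc'⟩ := Finset.not_disjoint_iff.1 hdis
    have hpos := Finset.card_pos.2 ⟨c, Finset.mem_inter.2 ⟨hc, hc'⟩⟩
    refine ⟨U ∪ U', Or.inr (Or.inl ⟨U, U', hU, hU', hd, by omega, rfl⟩), subset_rfl,
      Finset.subset_union_left, ?_⟩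
    refine hU.1.2.1.union hU'.1.2.1 hc hc' x ?_ y ?_
    · exact support_mono Finset.subset_union_left hx
    · exact support_mono Finset.subset_union_right hy

theorem exists_ne_of_even_card_filter {ι : Type*} {s : Finset ι} {q : ι → Prop}
    [DecidablePred q] (h : Even (s.filter q).card) {i : ι} (hi : i ∈ s) (hq : q i) :
    ∃ j ∈ s, j ≠ i ∧ q j := by
  have hi' : i ∈ s.filter q := Finset.mem_filter.2 ⟨hi, hq⟩
  have hpos := Finset.card_pos.2 ⟨i, hi'⟩
  obtain ⟨j, hj, hji⟩ := Finset.exists_mem_ne (s := s.filter q) (by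
    rw [Nat.even_iff] at h
    omega) i
  exact ⟨j, (Finset.mem_filter.1 hj).1, hji, (Finset.mem_filter.1 hj).2⟩

theorem card_filter_erase_erase {ι : Type*} [DecidableEq ι] {s : Finset ι} {i j : ι}
    (hi : i ∈ s) (hj : j ∈ s) (hji : j ≠ i) (q : ι → Prop) [DecidablePred q] :
    (s.filter q).card = (((s.erase i).erase j).filter q).card
      + ((if q i then 1 else 0) + (if q j then 1 else 0)) := by
  simp only [Finset.card_filter]
  rw [← Finset.sum_erase_add s _ hi, ← Finset.sum_erase_add (s.erase i) _
    (Finset.mem_erase.2 ⟨hji, hj⟩)]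
  omega

theorem card_erase_erase_lt {ι : Type*} [DecidableEq ι] {s : Finset ι} {i : ι} (hi : i ∈ s)
    (j : ι) :
    ((s.erase i).erase j).card < s.card :=
  (Finset.card_le_card (Finset.erase_subset _ _)).trans_lt (Finset.card_erase_lt_of_mem hi)

/-- If every component of `L` contains an even number of terminals, then `L` has a subset whose
degrees have the parity of the number of terminals at each vertex. -/
theorem exists_join {ι : Type*} (L : Finset G.E) (t : ι → G.V) (I : Finset ι)
    (h : ∀ v, Even (I.filter fun i => G.Reach L v (t i)).card) :
    ∃ J ⊆ L, ∀ v, (G.degIn J v : ZMod 2) = ((I.filter fun i => t i = v).card : ZMod 2) := by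
  induction hn : I.card using Nat.strong_induction_on generalizing I with
  | _ n ih =>
    rcases I.eq_empty_or_nonempty with rfl | ⟨i, hi⟩
    · exact ⟨∅, by simp, by simp [degIn]⟩
    obtain ⟨j, hj, hji, hr⟩ := exists_ne_of_even_card_filter (h (t i)) hi (Reach.refl _ _)
    obtain ⟨P, hPL, -, hP⟩ := hr.exists_parity_path
    obtain ⟨J, hJL, hJ⟩ := ih _ (hn ▸ card_erase_erase_lt hi j) ((I.erase i).erase j) (fun v => by
      have h1 := h v
      rw [card_filter_erase_erase hi hj hji] at h1
      have h2 : G.Reach L v (t i) ↔ G.Reach L v (t j) :=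
        ⟨fun h => h.trans hr, fun h => h.trans hr.symm⟩
      by_cases h3 : G.Reach L v (t j)
      · simp only [h2, h3, if_true] at h1
        rw [Nat.even_add] at h1
        exact h1.2 (by decide)
      · simpa only [h2, h3, if_false, add_zero] using h1) rfl
    refine ⟨symmDiff J P, ?_, fun v => ?_⟩
    · intro e he
      rcases Finset.mem_symmDiff.1 he with h | h
      · exact hJL h.1
      · exact hPL h.1
    · rw [degIn_symmDiff, hJ, hP, card_filter_erase_erase hi hj hji]
      push_cast
      simp only [eq_comm]

theorem coverCount_cons (F : Multiset (Finset G.E)) (B : Finset G.E) (e : G.E) :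
    G.coverCount (B ::ₘ F) e = G.coverCount F e + (if e ∈ B then 1 else 0) := by
  unfold coverCount
  split_ifs with h <;> simp [h]

/-- Pair up unbalanced circuits along a join `J` and take the resulting barbells. -/
theorem exists_barbell_family (t : Finset G.E → G.V) (𝒰 : Finset (Finset G.E)) (J : Finset G.E)
    (hU : ∀ U ∈ 𝒰, G.IsUnbalancedCircuit U) (ht : ∀ U ∈ 𝒰, t U ∈ G.support U)
    (hd : ∀ U ∈ 𝒰, ∀ U' ∈ 𝒰, U ≠ U' → Disjoint U U')
    (hcard : ∀ U ∈ 𝒰, ∀ U' ∈ 𝒰, U ≠ U' → (G.support U ∩ G.support U').card ≤ 1)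
    (hJ : ∀ v, (G.degIn J v : ZMod 2) = ((𝒰.filter fun U => t U = v).card : ZMod 2)) :
    ∃ F : Multiset (Finset G.E), (∀ S ∈ F, G.IsSignedCircuit S) ∧
      (∀ e, (𝒰.filter fun U => e ∈ U).card ≤ G.coverCount F e) ∧
      (∀ e, G.coverCount F e ≤ (𝒰.filter fun U => e ∈ U).card + (if e ∈ J then 1 else 0)) ∧
      ∀ W f, G.boundary Finset.univ W = {f} → ¬ Even (𝒰.filter fun U => t U ∈ W).card →
        1 ≤ G.coverCount F f := by
  induction hn : 𝒰.card using Nat.strong_induction_on generalizing 𝒰 J with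
  | _ n ih =>
    rcases 𝒰.eq_empty_or_nonempty with rfl | ⟨U, hUm⟩
    · exact ⟨0, by simp [coverCount]⟩
    have heven : Even (𝒰.filter fun U' => G.Reach J (t U) (t U')).card := by
      have h := sum_degIn_eq_card_boundary J (Finset.univ.filter fun u => G.Reach J (t U) u)
      rw [boundary_reach_eq_empty, Finset.card_empty, Nat.cast_zero] at h
      rw [← ZMod.natCast_eq_zero_iff_even, ← h, Finset.card_eq_sum_card_fiberwise
        (f := t) (t := Finset.univ.filter fun u => G.Reach J (t U) u)
        (fun x hx => by simpa using (Finset.mem_filter.1 hx).2), Nat.cast_sum]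
      refine Finset.sum_congr rfl fun v hv => ?_
      rw [hJ, Finset.filter_filter]
      congr 2
      refine Finset.filter_congr fun U' _ => ⟨fun h => h.2, fun h => ⟨?_, h⟩⟩
      rw [h]
      simpa using hv
    obtain ⟨U', hUm', hne, hr⟩ := exists_ne_of_even_card_filter heven hUm (Reach.refl _ _)
    obtain ⟨P, hPJ, hPr, hP⟩ := hr.exists_parity_path
    obtain ⟨B, hB, hUB, hBU, hBr⟩ := exists_barbell (hU U hUm) (hU U' hUm')
      (hd U hUm U' hUm' hne.symm) (hcard U hUm U' hUm' hne.symm) (ht U hUm) (ht U' hUm') hPr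
    have hsub : ∀ {D}, D ∈ (𝒰.erase U).erase U' → D ∈ 𝒰 := fun h =>
      Finset.mem_of_mem_erase (Finset.mem_of_mem_erase h)
    obtain ⟨F, hF1, hF2, hF3, hF4⟩ := ih _ (hn ▸ card_erase_erase_lt hUm U')
      ((𝒰.erase U).erase U') (J \ P) (fun D hD => hU D (hsub hD)) (fun D hD => ht D (hsub hD))
      (fun D hD D' hD' => hd D (hsub hD) D' (hsub hD'))
      (fun D hD D' hD' => hcard D (hsub hD) D' (hsub hD'))
      (fun v => by
        have h := congrArg (Nat.cast (R := ZMod 2)) (degIn_sdiff_add hPJ v)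
        rw [Nat.cast_add, hJ, hP, card_filter_erase_erase hUm hUm' hne] at h
        push_cast at h
        simp only [eq_comm (a := v)] at h
        exact add_right_cancel h) rfl
    have hUU' : ∀ e, e ∈ U → e ∉ U' := fun e he he' =>
      Finset.disjoint_left.1 (hd U hUm U' hUm' hne.symm) he he'
    refine ⟨B ::ₘ F, by simpa using ⟨hB, hF1⟩, fun e => ?_, fun e => ?_, fun W f hW hodd => ?_⟩
    · rw [card_filter_erase_erase hUm hUm' hne, coverCount_cons]
      have h1 := hF2 e
      have h2 := hUU' e
      have h3 : e ∈ U ∨ e ∈ U' → e ∈ B := fun h => hUB (Finset.mem_union.2 h)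
      split_ifs <;> first | omega | tauto
    · rw [card_filter_erase_erase hUm hUm' hne, coverCount_cons]
      have h1 := hF3 e
      have h3 : e ∈ B → (e ∈ U ∨ e ∈ U') ∨ e ∈ P := fun h => by simpa [or_assoc] using hBU h
      have h4 := @hPJ e
      simp only [Finset.mem_sdiff] at h1
      split_ifs at h1 ⊢ <;> first | omega | tauto
    · rw [coverCount_cons]
      rw [card_filter_erase_erase hUm hUm' hne] at hodd
      have hcross : ¬ (t U ∈ W ↔ t U' ∈ W) → f ∈ B := fun h => by
        obtain ⟨e, he⟩ : (G.boundary B W).Nonempty := by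
          by_cases h1 : t U ∈ W
          · exact hBr.exists_crossing h1 (by tauto)
          · exact hBr.symm.exists_crossing (by tauto) h1
        have he' := Finset.mem_filter.1 he
        have : e ∈ G.boundary Finset.univ W := Finset.mem_filter.2 ⟨Finset.mem_univ _, he'.2⟩
        rw [hW, Finset.mem_singleton] at this
        exact this ▸ he'.1
      by_cases h : t U ∈ W ↔ t U' ∈ W
      · refine le_add_right (hF4 W f hW fun hev => hodd (hev.add ?_))
        simp only [h]
        split_ifs <;> decide
      · simp [hcross h]

/-! ### Families of disjoint edge sets -/

theorem eq_biUnion {S : Finset G.E} {𝒜 : Finset (Finset G.E)}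
    (hS : ∀ e, e ∈ S ↔ ∃ A ∈ 𝒜, e ∈ A) : S = 𝒜.biUnion id := by
  ext e
  simp [hS]

theorem degIn_eq_sum_family {S : Finset G.E} {𝒜 : Finset (Finset G.E)}
    (hd : ∀ A ∈ 𝒜, ∀ A' ∈ 𝒜, A ≠ A' → Disjoint A A') (hS : ∀ e, e ∈ S ↔ ∃ A ∈ 𝒜, e ∈ A)
    (v : G.V) : G.degIn S v = ∑ A ∈ 𝒜, G.degIn A v := by
  rw [eq_biUnion hS]
  exact Finset.sum_biUnion hd

/-- The number of negative edges of `S` with both ends in `W`. -/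
def negWithin (S : Finset G.E) (W : Finset G.V) : ℕ :=
  ((G.negEdges S).filter fun e => ∀ v ∈ G.ends e, v ∈ W).card

theorem negWithin_eq_sum_family {S : Finset G.E} {𝒜 : Finset (Finset G.E)}
    (hd : ∀ A ∈ 𝒜, ∀ A' ∈ 𝒜, A ≠ A' → Disjoint A A') (hS : ∀ e, e ∈ S ↔ ∃ A ∈ 𝒜, e ∈ A)
    (W : Finset G.V) : negWithin S W = ∑ A ∈ 𝒜, negWithin A W := by
  rw [eq_biUnion hS]
  simp only [negWithin, negEdges, Finset.filter_biUnion]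
  exact Finset.card_biUnion fun A hA A' hA' h =>
    Finset.disjoint_filter_filter (Finset.disjoint_filter_filter (hd A hA A' hA' h))

theorem ConnOn.support_subset {S : Finset G.E} (hS : G.ConnOn S) {W : Finset G.V}
    (hW : G.boundary S W = ∅) {v : G.V} (hv : v ∈ G.support S) (hvW : v ∈ W) :
    G.support S ⊆ W := fun u hu => by
  by_contra huW
  simpa [hW] using (hS v hv u hu).exists_crossing hvW huW

theorem ConnOn.negWithin_eq {S : Finset G.E} (hS : G.ConnOn S) {W : Finset G.V}
    (hW : G.boundary S W = ∅) {v : G.V} (hv : v ∈ G.support S) :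
    negWithin S W = if v ∈ W then (G.negEdges S).card else 0 := by
  split_ifs with hvW
  · refine congrArg Finset.card (Finset.filter_true_of_mem fun e he u hu => ?_)
    exact hS.support_subset hW hv hvW (mem_support.2 ⟨e, (Finset.mem_filter.1 he).1, hu⟩)
  · refine Finset.card_eq_zero.2 (Finset.filter_false_of_mem fun e he h => hvW ?_)
    obtain ⟨a, b, hab⟩ := exists_ends e
    have ha : a ∈ G.ends e := by simp [hab]
    exact hS.support_subset hW (mem_support.2 ⟨e, (Finset.mem_filter.1 he).1, ha⟩) (h a ha) hv

theorem boundary_mono {S T : Finset G.E} (h : S ⊆ T) (W : Finset G.V) :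
    G.boundary S W ⊆ G.boundary T W :=
  Finset.filter_subset_filter _ h

theorem exists_mem_support {S : Finset G.E} (h : S.Nonempty) : ∃ v, v ∈ G.support S := by
  obtain ⟨e, he⟩ := h
  obtain ⟨a, b, hab⟩ := exists_ends e
  exact ⟨a, mem_support.2 ⟨e, he, by simp [hab]⟩⟩

/-! ### Generalized barbells -/

section GenBarbell

variable {ℬ : Finset (Finset G.E)}

theorem mem_sup_family {e : G.E} : e ∈ ℬ.sup id ↔ ∃ B ∈ ℬ, e ∈ B := by
  simp [Finset.mem_sup]

theorem GenBarbellWitness.disjoint {S : Finset G.E} (h : G.GenBarbellWitness S ℬ) :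
    ∀ B ∈ ℬ, ∀ B' ∈ ℬ, B ≠ B' → Disjoint B B' := fun B hB B' hB' hne => by
  refine Finset.disjoint_left.2 fun e he he' => ?_
  obtain ⟨a, b, hab⟩ := exists_ends e
  have ha : a ∈ G.ends e := by simp [hab]
  exact Finset.disjoint_left.1 (h.2.1 B hB B' hB' hne) (mem_support.2 ⟨e, he, ha⟩)
    (mem_support.2 ⟨e, he', ha⟩)

theorem GenBarbellWitness.degIn_sup_parity {S : Finset G.E} (h : G.GenBarbellWitness S ℬ)
    (v : G.V) : (G.degIn (ℬ.sup id) v : ZMod 2) = 0 := by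
  rw [degIn_eq_sum_family h.disjoint (fun _ => mem_sup_family), Nat.cast_sum]
  refine Finset.sum_eq_zero fun B hB => ?_
  by_cases hv : v ∈ G.support B
  · exact (ZMod.natCast_eq_zero_iff_even).2 ((h.1 B hB).2.2.2 v hv)
  · simp [degIn_eq_zero_iff.2 hv]

theorem GenBarbellWitness.boundary_classOf {S : Finset G.E} (h : G.GenBarbellWitness S ℬ)
    (v : G.V) : G.boundary (ℬ.sup id) (G.classOf ℬ v) = ∅ := by
  refine Finset.filter_eq_empty_iff.2 fun e he => ?_
  obtain ⟨B, hB, heB⟩ := mem_sup_family.1 he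
  obtain ⟨a, b, hab⟩ := exists_ends e
  have ha : a ∈ G.support B := mem_support.2 ⟨e, heB, by simp [hab]⟩
  have hb : b ∈ G.support B := mem_support.2 ⟨e, heB, by simp [hab]⟩
  have key : ∀ x ∈ G.support B, ∀ y ∈ G.support B, x ∈ G.classOf ℬ v → y ∈ G.classOf ℬ v := by
    intro x hx y hy hxv
    simp only [classOf, Finset.mem_filter, Finset.mem_univ, true_and] at hxv ⊢
    rcases hxv with rfl | ⟨B', hB', hv, hx'⟩
    · exact Or.inr ⟨B, hB, hx, hy⟩
    · by_cases hBB : B = B'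
      · exact Or.inr ⟨B, hB, hBB ▸ hv, hy⟩
      · exact absurd hx' (Finset.disjoint_left.1 (h.2.1 B hB B' hB' hBB) hx)
  rw [crossesB_iff hab, not_not]
  exact ⟨key a ha b hb, key b hb a ha⟩

/-- Every edge outside the eulerian parts is a bridge. -/
theorem GenBarbellWitness.exists_cut (h : G.GenBarbellWitness Finset.univ ℬ) {f : G.E}
    (hf : f ∉ ℬ.sup id) : ∃ W, G.boundary Finset.univ W = {f} := by
  obtain ⟨a, b, hab⟩ := exists_ends f
  have hnr : ¬ G.Reach (Finset.univ \ {f}) a b := fun hr => by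
    obtain ⟨P, hPf, -, hP⟩ := hr.exists_parity_path
    have hfP : f ∉ P := fun hfP => by simpa using hPf hfP
    have hdeg : ∀ v, (G.degIn ({f} ∪ P) v : ZMod 2) = 0 := fun v => by
      rw [degIn_union (by simpa using hfP), Nat.cast_add, hP, degIn_singleton hab]
      push_cast
      exact CharTwo.add_self_eq_zero _
    obtain ⟨v, hv⟩ := h.2.2.1 (({f} ∪ P) \ ℬ.sup id)
      (Finset.sdiff_subset_sdiff (Finset.subset_univ _) subset_rfl) ⟨f, by simp [hf]⟩
    have h1 : ∀ u, (G.degIn (({f} ∪ P) \ ℬ.sup id) u : ZMod 2)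
        = G.degIn (({f} ∪ P) ∩ ℬ.sup id) u := fun u => by
      have := congrArg (Nat.cast (R := ZMod 2))
        (degIn_sdiff_add (Finset.inter_subset_left : ({f} ∪ P) ∩ ℬ.sup id ⊆ _) u)
      rw [Nat.cast_add, hdeg, Finset.sdiff_inter_self_left] at this
      exact CharTwo.add_eq_zero.1 this
    have h2 := congrArg (Nat.cast (R := ZMod 2)) hv
    rw [classDeg, Nat.cast_sum, Finset.sum_congr rfl fun u _ => h1 u, sum_degIn_eq_card_boundary,
      Finset.subset_empty.1 ((boundary_mono Finset.inter_subset_right _).trans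
        (h.boundary_classOf v).subset)] at h2
    simp at h2
  refine ⟨Finset.univ.filter fun u => G.Reach (Finset.univ \ {f}) a u,
    Finset.eq_singleton_iff_unique_mem.2 ⟨?_, fun e he => ?_⟩⟩
  · simp [boundary, crossesB_iff hab, hnr, Reach.refl]
  · by_contra hef
    have : e ∈ G.boundary (Finset.univ \ {f})
        (Finset.univ.filter fun u => G.Reach (Finset.univ \ {f}) a u) :=
      Finset.mem_filter.2 ⟨by simpa using hef, (Finset.mem_filter.1 he).2⟩
    simp [boundary_reach_eq_empty] at this

/-- The parity condition of a generalized barbell, summed over a set `W` of vertices that does not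
separate any eulerian part. -/
theorem GenBarbellWitness.negWithin_parity (h : G.GenBarbellWitness Finset.univ ℬ)
    {W : Finset G.V} (hW : G.boundary (ℬ.sup id) W = ∅) :
    (negWithin (ℬ.sup id) W : ZMod 2) = ((G.boundary Finset.univ W).card : ZMod 2) := by
  have hWB : ∀ B ∈ ℬ, G.boundary B W = ∅ := fun B hB => Finset.subset_empty.1
    ((boundary_mono (fun e he => mem_sup_family.2 ⟨B, hB, he⟩) W).trans hW.subset)
  rw [negWithin_eq_sum_family h.disjoint (fun _ => mem_sup_family), Nat.cast_sum,
    ← sum_degIn_eq_card_boundary]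
  have h1 : ∀ B ∈ ℬ, (negWithin B W : ZMod 2) = if G.support B ⊆ W then
      ∑ v ∈ G.support B, (G.degIn Finset.univ v : ZMod 2) else 0 := fun B hB => by
    obtain ⟨hne, hconn, -⟩ := (h.1 B hB).2
    obtain ⟨v, hv⟩ := exists_mem_support hne
    have hiff : v ∈ W ↔ G.support B ⊆ W :=
      ⟨hconn.support_subset (hWB B hB) hv, fun hs => hs hv⟩
    rw [hconn.negWithin_eq (hWB B hB) hv, sum_degIn_eq_card_boundary]
    simp only [hiff]
    split_ifs
    · exact (ZMod.natCast_eq_natCast_iff _ _ _).2 (h.2.2.2.1 B hB)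
    · simp
  rw [Finset.sum_congr rfl h1, ← Finset.sum_filter, ← Finset.sum_biUnion]
  · refine Finset.sum_subset (Finset.biUnion_subset.2 fun B hB => (Finset.mem_filter.1 hB).2)
      fun v hvW hv => ?_
    have hvB : ∀ B ∈ ℬ, v ∉ G.support B := fun B hB hvB => hv (Finset.mem_biUnion.2
      ⟨B, Finset.mem_filter.2 ⟨hB, (h.1 B hB).2.2.1.support_subset (hWB B hB) hvB hvW⟩, hvB⟩)
    by_cases hvs : v ∈ G.support Finset.univ
    · have := sum_degIn_eq_card_boundary Finset.univ {v}
      rw [Finset.sum_singleton] at this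
      rw [this]
      exact (ZMod.natCast_eq_zero_iff_even).2 (h.2.2.2.2 v hvs hvB)
    · simp [degIn_eq_zero_iff.2 hvs]
  · intro B hB B' hB' hne
    exact h.2.1 B (Finset.mem_filter.1 hB).1 B' (Finset.mem_filter.1 hB').1 hne

end GenBarbell

theorem negWithin_parity_of_decomposition {S : Finset G.E} {𝒟 : Finset (Finset G.E)}
    (hC : ∀ C ∈ 𝒟, G.IsCircuit C) (hd : ∀ C ∈ 𝒟, ∀ C' ∈ 𝒟, C ≠ C' → Disjoint C C')
    (hS : ∀ e, e ∈ S ↔ ∃ C ∈ 𝒟, e ∈ C) {t : Finset G.E → G.V}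
    (ht : ∀ C ∈ 𝒟.filter G.IsUnbalancedCircuit, t C ∈ G.support C) {W : Finset G.V}
    (hW : G.boundary S W = ∅) :
    (negWithin S W : ZMod 2)
      = (((𝒟.filter G.IsUnbalancedCircuit).filter fun U => t U ∈ W).card : ZMod 2) := by
  rw [negWithin_eq_sum_family hd hS, Finset.filter_filter, Finset.card_filter, Nat.cast_sum,
    Nat.cast_sum]
  refine Finset.sum_congr rfl fun C hCD => ?_
  have hWC : G.boundary C W = ∅ := Finset.subset_empty.1
    ((boundary_mono (fun e he => (hS e).2 ⟨C, hCD, he⟩) W).trans hW.subset)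
  by_cases hu : G.IsUnbalancedCircuit C
  · rw [(hC C hCD).2.1.negWithin_eq hWC (ht C (Finset.mem_filter.2 ⟨hCD, hu⟩))]
    simp only [hu, true_and]
    split_ifs
    · exact (ZMod.natCast_eq_one_iff_odd).2 (Nat.not_even_iff_odd.1 hu.2)
    · simp
  · obtain ⟨v, hv⟩ := exists_mem_support (hC C hCD).1
    have hev : Even (G.negEdges C).card := by
      by_contra hcon
      exact hu ⟨hC C hCD, hcon⟩
    rw [(hC C hCD).2.1.negWithin_eq hWC hv]
    simp only [hu, false_and, if_false]
    split_ifs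
    · simpa using (ZMod.natCast_eq_zero_iff_even).2 hev
    · simp

/-- Two members `C₁`, `C₂` of a family of connected edge sets can be deleted so that terminals of
the members lying in the same component remain in the same component. -/
theorem exists_two_removable {𝒰 : Finset (Finset G.E)} (hconn : ∀ U ∈ 𝒰, G.ConnOn U)
    {t₀ : Finset G.E → G.V} (ht₀ : ∀ U ∈ 𝒰, t₀ U ∈ G.support U)
    (heven : ∀ v, Even (𝒰.filter fun U => G.Reach Finset.univ v (t₀ U)).card)
    (hne : 𝒰.Nonempty) :
    ∃ C₁ ∈ 𝒰, ∃ C₂ ∈ 𝒰, C₁ ≠ C₂ ∧ ∃ t : Finset G.E → G.V,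
      (∀ U ∈ 𝒰, t U ∈ G.support U) ∧
      ∀ U ∈ 𝒰, ∀ U' ∈ 𝒰, G.Reach Finset.univ (t U) (t U') →
        G.Reach (Finset.univ \ (C₁ ∪ C₂)) (t U) (t U') := by
  obtain ⟨U₀, hU₀⟩ := hne
  set v₀ := t₀ U₀
  set 𝒦 := 𝒰.filter fun U => G.Reach Finset.univ v₀ (t₀ U) with h𝒦
  have hU₀K : U₀ ∈ 𝒦 := Finset.mem_filter.2 ⟨hU₀, Reach.refl _ _⟩
  obtain ⟨C₁, hC₁, h₁⟩ := exists_removable (S := Finset.univ) (v := v₀) ⟨U₀, hU₀K⟩ fun U hU =>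
    ⟨t₀ U, ht₀ U (Finset.mem_filter.1 hU).1, (Finset.mem_filter.1 hU).2⟩
  obtain ⟨t₁, ht₁, hr₁⟩ := h₁ C₁ hC₁
  have hne : (𝒦.erase C₁).Nonempty := by
    obtain ⟨U, hU, hUC, hr⟩ := exists_ne_of_even_card_filter (heven v₀)
      (Finset.mem_filter.1 hC₁).1 (Finset.mem_filter.1 hC₁).2
    exact ⟨U, Finset.mem_erase.2 ⟨hUC, Finset.mem_filter.2 ⟨hU, hr⟩⟩⟩
  obtain ⟨C₂, hC₂, h₂⟩ := exists_removable (S := Finset.univ \ C₁) (v := t₁) hne fun U hU => by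
    obtain ⟨u, hu, hr⟩ := h₁ U (Finset.mem_of_mem_erase hU)
    exact ⟨u, hu, hr₁.symm.trans hr⟩
  rw [sdiff_sdiff_left, Finset.sup_eq_union] at h₂
  have hex : ∀ U, ∃ u, U ∈ 𝒰 → u ∈ G.support U ∧
      (G.Reach Finset.univ v₀ u → G.Reach (Finset.univ \ (C₁ ∪ C₂)) t₁ u) := fun U => by
    by_cases hU : U ∈ 𝒰
    · by_cases hUC : U = C₁
      · exact ⟨t₁, fun _ => ⟨hUC ▸ ht₁, fun _ => Reach.refl _ _⟩⟩
      · by_cases hUK : U ∈ 𝒦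
        · obtain ⟨u, hu, hr⟩ := h₂ U (Finset.mem_erase.2 ⟨hUC, hUK⟩)
          exact ⟨u, fun _ => ⟨hu, fun _ => hr⟩⟩
        · refine ⟨t₀ U, fun _ => ⟨ht₀ U hU, fun hr => ?_⟩⟩
          exact absurd (Finset.mem_filter.2 ⟨hU, hr⟩) hUK
    · exact ⟨v₀, fun h => absurd h hU⟩
  choose t ht using hex
  have hC₂K := Finset.mem_of_mem_erase hC₂
  have hsupp : ∀ w ∈ G.support (C₁ ∪ C₂), G.Reach Finset.univ v₀ w := fun w hw => by
    rw [support_union, Finset.mem_union] at hw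
    have key : ∀ C ∈ 𝒦, w ∈ G.support C → G.Reach Finset.univ v₀ w := fun C hC hwC => by
      have hC' := Finset.mem_filter.1 hC
      exact hC'.2.trans ((hconn C hC'.1 _ (ht₀ C hC'.1) w hwC).mono (Finset.subset_univ _))
    exact hw.elim (key C₁ hC₁) (key C₂ hC₂K)
  refine ⟨C₁, (Finset.mem_filter.1 hC₁).1, C₂, (Finset.mem_filter.1 hC₂K).1,
    (Finset.ne_of_mem_erase hC₂).symm, t, fun U hU => (ht U hU).1, fun U hU U' hU' hr => ?_⟩
  rcases hr.avoid (C := C₁ ∪ C₂) with ⟨w, hw, hrw⟩ | hr'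
  · have hv : G.Reach Finset.univ v₀ (t U) :=
      (hsupp w hw).trans (hrw.mono (Finset.subset_univ _)).symm
    exact ((ht U hU).2 hv).symm.trans ((ht U' hU').2 (hv.trans hr))
  · exact hr'

theorem coverCount_add (F F' : Multiset (Finset G.E)) (e : G.E) :
    G.coverCount (F + F') e = G.coverCount F e + G.coverCount F' e := by
  simp [coverCount]

theorem coverCount_val (𝒟 : Finset (Finset G.E)) (e : G.E) :
    G.coverCount 𝒟.val e = (𝒟.filter fun C => e ∈ C).card := rfl

end SignedMultigraph

open SignedMultigraph

/-- Every generalized barbell `H` either (i) decomposes into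
balanced circuits, or (ii) has a signed circuit `{1,2}`-cover `F` together with
two edge-disjoint unbalanced circuits `C₁`, `C₂` all of whose edges are covered
by `F` exactly once. -/
theorem genBarbell_decomp_or_12cover (G : SignedMultigraph)
    (hgb : G.IsGenBarbell Finset.univ) :
    (∃ D : Multiset (Finset G.E),
        (∀ C ∈ D, G.IsBalancedCircuit C) ∧ ∀ e : G.E, G.coverCount D e = 1) ∨
    (∃ (F : Multiset (Finset G.E)) (C₁ C₂ : Finset G.E),
        (∀ S ∈ F, G.IsSignedCircuit S) ∧
        (∀ e : G.E, G.coverCount F e = 1 ∨ G.coverCount F e = 2) ∧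
        G.IsUnbalancedCircuit C₁ ∧ G.IsUnbalancedCircuit C₂ ∧
        Disjoint C₁ C₂ ∧
        ∀ e ∈ C₁ ∪ C₂, G.coverCount F e = 1) := by
  obtain ⟨ℬ, hw⟩ := hgb
  obtain ⟨𝒟, hC, hd, hone, hE⟩ := exists_circuit_decomposition _ hw.degIn_sup_parity
  set 𝒰 := 𝒟.filter G.IsUnbalancedCircuit with h𝒰
  have hUD : ∀ {U}, U ∈ 𝒰 → U ∈ 𝒟 := fun h => (Finset.mem_filter.1 h).1
  have hUu : ∀ U ∈ 𝒰, G.IsUnbalancedCircuit U := fun U h => (Finset.mem_filter.1 h).2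
  have hparity : ∀ {t : Finset G.E → G.V} (_ : ∀ U ∈ 𝒰, t U ∈ G.support U) {W : Finset G.V},
      G.boundary (ℬ.sup id) W = ∅ → ((𝒰.filter fun U => t U ∈ W).card : ZMod 2)
        = ((G.boundary Finset.univ W).card : ZMod 2) := fun ht W hW =>
    (negWithin_parity_of_decomposition hC hd hE ht hW).symm.trans (hw.negWithin_parity hW)
  have heven : ∀ {t : Finset G.E → G.V} (_ : ∀ U ∈ 𝒰, t U ∈ G.support U) (v : G.V),
      Even (𝒰.filter fun U => G.Reach Finset.univ v (t U)).card := fun ht v => by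
    have hb := boundary_reach_eq_empty Finset.univ v
    have h := hparity ht (Finset.subset_empty.1
      ((boundary_mono (Finset.subset_univ (ℬ.sup id)) _).trans hb.subset))
    rw [hb, Finset.card_empty, Nat.cast_zero, ZMod.natCast_eq_zero_iff_even] at h
    simpa using h
  have hcut : ∀ {t : Finset G.E → G.V} (_ : ∀ U ∈ 𝒰, t U ∈ G.support U) {f : G.E},
      f ∉ ℬ.sup id → ∃ W, G.boundary Finset.univ W = {f} ∧
        ¬ Even (𝒰.filter fun U => t U ∈ W).card := fun ht f hf => by
    obtain ⟨W, hW⟩ := hw.exists_cut hf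
    have hb : G.boundary (ℬ.sup id) W = ∅ := by
      refine Finset.eq_empty_of_forall_notMem fun e he => hf ?_
      have hef := boundary_mono (Finset.subset_univ (ℬ.sup id)) W he
      rw [hW, Finset.mem_singleton] at hef
      exact hef ▸ (Finset.mem_filter.1 he).1
    refine ⟨W, hW, ?_⟩
    rw [← ZMod.natCast_eq_zero_iff_even, hparity ht hb, hW]
    simp
  have hin : ∀ e ∈ ℬ.sup id, (𝒟.filter fun C => e ∈ C).card = 1 := fun e he => by
    obtain ⟨C, hCD, heC⟩ := (hE e).1 he
    refine Finset.card_eq_one.2 ⟨C, Finset.eq_singleton_iff_unique_mem.2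
      ⟨Finset.mem_filter.2 ⟨hCD, heC⟩, fun C' hC' => ?_⟩⟩
    rw [Finset.mem_filter] at hC'
    by_contra hne
    exact Finset.disjoint_left.1 (hd C' hC'.1 C hCD hne) hC'.2 heC
  rcases 𝒰.eq_empty_or_nonempty with hU | hU
  · refine Or.inl ⟨𝒟.val, fun C hCD => ⟨hC C hCD, ?_⟩, fun e => ?_⟩
    · by_contra hcon
      have hCU : C ∈ 𝒰 := Finset.mem_filter.2 ⟨hCD, hC C hCD, hcon⟩
      simp [hU] at hCU
    · rw [coverCount_val]
      refine hin e ?_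
      by_contra he
      obtain ⟨a, -, -⟩ := exists_ends e
      obtain ⟨W, -, hW⟩ := hcut (t := fun _ => a) (by simp [hU]) he
      simp [hU] at hW
  · have hsupp : ∀ U, ∃ v, U ∈ 𝒰 → v ∈ G.support U := fun U => by
      obtain ⟨U₀, hU₀⟩ := hU
      by_cases h : U ∈ 𝒰
      · obtain ⟨v, hv⟩ := exists_mem_support (hUu U h).1.1
        exact ⟨v, fun _ => hv⟩
      · obtain ⟨v, -⟩ := exists_mem_support (hUu U₀ hU₀).1.1
        exact ⟨v, fun h' => absurd h' h⟩
    choose t₀ ht₀ using hsupp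
    obtain ⟨C₁, hC₁, C₂, hC₂, hne, t, ht, hreach⟩ :=
      exists_two_removable (fun U h => (hUu U h).1.2.1) ht₀ (heven ht₀) hU
    obtain ⟨J, hJL, hJ⟩ := exists_join (Finset.univ \ (C₁ ∪ C₂)) t 𝒰 fun v => by
      by_cases hv : ∃ U ∈ 𝒰, G.Reach (Finset.univ \ (C₁ ∪ C₂)) v (t U)
      · obtain ⟨U, hUm, hr⟩ := hv
        convert heven ht v using 2
        refine Finset.filter_congr fun U' hU' => ⟨fun h => h.mono (Finset.subset_univ _),
          fun h => hr.trans (hreach U hUm U' hU' ?_)⟩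
        exact (hr.mono (Finset.subset_univ _)).symm.trans h
      · rw [Finset.filter_false_of_mem fun U hUm h => hv ⟨U, hUm, h⟩]
        simp
    obtain ⟨F, hF, hF₁, hF₂, hF₃⟩ := exists_barbell_family t 𝒰 J hUu ht
      (fun U h U' h' => hd U (hUD h) U' (hUD h'))
      (fun U h U' h' hne => hone U (hUD h) U' (hUD h') hne (hUu U h) (hUu U' h')) hJ
    have hsplit : ∀ e, (𝒟.filter fun C => e ∈ C).card
        = ((𝒟.filter fun C => ¬ G.IsUnbalancedCircuit C).filter fun C => e ∈ C).card
          + (𝒰.filter fun C => e ∈ C).card := fun e => by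
      rw [h𝒰, Finset.filter_comm, Finset.filter_comm (p := G.IsUnbalancedCircuit), add_comm,
        Finset.card_filter_add_card_filter_not]
    have hcover : ∀ e ∈ ℬ.sup id,
        1 ≤ G.coverCount ((𝒟.filter fun C => ¬ G.IsUnbalancedCircuit C).val + F) e ∧
        G.coverCount ((𝒟.filter fun C => ¬ G.IsUnbalancedCircuit C).val + F) e
          ≤ 1 + (if e ∈ J then 1 else 0) := fun e he => by
      have h1 := hin e he
      have h2 := hsplit e
      have h3 := hF₁ e
      have h4 := hF₂ e
      rw [coverCount_add, coverCount_val]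
      omega
    refine Or.inr ⟨(𝒟.filter fun C => ¬ G.IsUnbalancedCircuit C).val + F, C₁, C₂, fun S hS => ?_,
      fun e => ?_, hUu C₁ hC₁, hUu C₂ hC₂, hd C₁ (hUD hC₁) C₂ (hUD hC₂) hne, fun e he => ?_⟩
    · rcases Multiset.mem_add.1 hS with hS | hS
      · obtain ⟨hSD, hSu⟩ := Finset.mem_filter.1 hS
        refine Or.inl ⟨hC S hSD, ?_⟩
        by_contra hcon
        exact hSu ⟨hC S hSD, hcon⟩
      · exact hF S hS
    · by_cases he : e ∈ ℬ.sup id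
      · have h := hcover e he
        split_ifs at h <;> omega
      · have h0 : (𝒟.filter fun C => e ∈ C).card = 0 :=
          Finset.card_eq_zero.2 (Finset.filter_false_of_mem fun C hCD heC =>
            he ((hE e).2 ⟨C, hCD, heC⟩))
        obtain ⟨W, hW, hodd⟩ := hcut ht he
        have h1 := hF₃ W e hW hodd
        have h2 := hsplit e
        have h3 := hF₂ e
        rw [coverCount_add, coverCount_val]
        split_ifs at h3 <;> omega
    · have heJ : e ∉ J := fun h => (Finset.mem_sdiff.1 (hJL h)).2 he
      have heE : e ∈ ℬ.sup id := (hE e).2 <| (Finset.mem_union.1 he).elim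
        (fun h => ⟨C₁, hUD hC₁, h⟩) (fun h => ⟨C₂, hUD hC₂, h⟩)
      have h := hcover e heE
      rw [if_neg heJ] at h
      omega
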